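/- arXiv:2011.14523 — 3 statements merged into one kernel-verified Lean document; each statement's English description precedes it below -/
import Mathlib

section
/- Let p be an odd prime, q = p^f, and let η be the quadratic character of F_q and ψ the canonical additive character. If the Gauss sum G(η) = Σ_{x ∈ F_q^*} ψ(x)η(x), then G(η) = ε · p^{f/2}, where ε = (-1)^{f-1} if p ≡ 1 (mod 4), and ε = (-1)^{f-1} i^f if p ≡ 3 (mod 4). -/
open Polynomial in
theorem cyclotomic_self_zmod (p : ℕ) [Fact p.Prime] :
    cyclotomic p (ZMod p) = (X - 1) ^ (p - 1) := by
  have h := cyclotomic_mul_prime_eq_pow_of_not_dvd (ZMod p) (p := p) (n := 1)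
    (Nat.Prime.not_dvd_one Fact.out)
  rwa [one_mul, cyclotomic_one] at h

open Polynomial in
theorem exists_sum_pow_mul_X_pow_eq (p : ℕ) [Fact p.Prime] (k : ℕ) (hk : k ≤ p - 1) :
    ∃ B : (ZMod p)[X], ∑ j ∈ Finset.range p, C ((j : ZMod p) ^ k) * X ^ j =
      (X - 1) ^ (p - 1 - k) * B ∧ B.eval 1 = (-1) ^ k * (k.factorial : ZMod p) := by
  have hp := (Fact.out : p.Prime).one_lt
  induction k with
  | zero =>
    refine ⟨1, ?_, by simp⟩
    simpa [cyclotomic_prime] using cyclotomic_self_zmod p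
  | succ k ih =>
    obtain ⟨B, hB, hB1⟩ := ih (by omega)
    obtain ⟨d, hd⟩ : ∃ d, p - 1 - k = d + 1 := ⟨p - 1 - (k + 1), by omega⟩
    have hd' : p - 1 - (k + 1) = d := by omega
    refine ⟨X * (C ((d + 1 : ℕ) : ZMod p) * B + (X - 1) * derivative B), ?_, ?_⟩
    · have h := congrArg (fun P => X * derivative P) hB
      simp only [derivative_sum, Finset.mul_sum] at h
      rw [hd] at h
      rw [hd']
      calc _ = _ := Finset.sum_congr rfl fun j _ => ?_
        _ = _ := h
        _ = _ := ?_
      · rw [derivative_C_mul, derivative_X_pow, map_natCast]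
        rcases j with _ | j
        · simp
        · rw [Nat.add_sub_cancel, pow_succ, C_mul, map_natCast, pow_succ X]
          ring
      · simp only [derivative_mul, derivative_pow, derivative_sub, derivative_X, derivative_one,
          map_natCast, Nat.add_sub_cancel]
        ring
    · have hc : ((d + 1 : ℕ) : ZMod p) = -((k + 1 : ℕ) : ZMod p) := by
        rw [eq_neg_iff_add_eq_zero, ← Nat.cast_add, show d + 1 + (k + 1) = p by omega,
          CharP.cast_eq_zero]
      simp only [eval_mul, eval_add, eval_X, eval_C, hB1, eval_sub, eval_one, sub_self, zero_mul,
        add_zero, one_mul, hc, Nat.factorial_succ]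
      push_cast
      ring

open Polynomial in
theorem exists_prod_X_pow_sub_one_eq (R : Type*) [CommRing R] (m : ℕ) :
    ∃ B : R[X], ∏ k ∈ Finset.range m, (X ^ (k + 1) - 1) = (X - 1) ^ m * B ∧
      B.eval 1 = (m.factorial : R) := by
  refine ⟨∏ k ∈ Finset.range m, ∑ i ∈ Finset.range (k + 1), X ^ i, ?_, ?_⟩
  · rw [← Finset.card_range m, ← Finset.prod_const, Finset.card_range, ← Finset.prod_mul_distrib]
    exact Finset.prod_congr rfl fun k _ => (mul_geom_sum X (k + 1)).symm
  · simp [eval_prod, eval_finsetSum, ← Finset.prod_range_add_one_eq_factorial]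

open Complex in
theorem exp_two_mul_I_sub_one (θ : ℝ) :
    exp (2 * θ * I) - 1 = exp (θ * I) * (2 * Real.sin θ : ℝ) * I := by
  have h : exp (θ * I) * exp (-(θ * I)) = 1 := by rw [← Complex.exp_add]; simp
  have h2 : exp (2 * θ * I) = exp (θ * I) * exp (θ * I) := by rw [← Complex.exp_add]; ring_nf
  push_cast
  rw [Complex.sin, neg_mul, h2]
  linear_combination h - (exp (-(θ * I)) * exp (θ * I) - exp (θ * I) * exp (θ * I)) * I_mul_I

theorem prod_two_mul_sin_range (n : ℕ) :
    ∏ k ∈ Finset.range n, (2 * Real.sin (Real.pi * (k + 1) / (n + 1))) = n + 1 := by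
  have h := congrArg norm
    (Complex.isPrimitiveRoot_exp (n + 1) (by omega)).prod_one_sub_pow_eq_order
  rw [norm_prod, show ‖(n : ℂ) + 1‖ = n + 1 by exact_mod_cast Complex.norm_natCast (n + 1)] at h
  refine Eq.trans (Finset.prod_congr rfl fun k hk => ?_) h
  have hk' : (k : ℝ) + 1 ≤ n + 1 := by
    exact_mod_cast (Nat.succ_lt_succ (Finset.mem_range.mp hk)).le
  have hs : 0 ≤ Real.sin (Real.pi * (k + 1) / (n + 1)) := by
    refine Real.sin_nonneg_of_nonneg_of_le_pi (by positivity) ?_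
    rw [div_le_iff₀ (by positivity)]
    gcongr
  have he := exp_two_mul_I_sub_one (Real.pi * (k + 1) / (n + 1))
  rw [← Complex.exp_nat_mul, norm_sub_rev, show ((k + 1 : ℕ) : ℂ) *
    (2 * Real.pi * Complex.I / ((n + 1 : ℕ) : ℂ)) =
      2 * ((Real.pi * (k + 1) / (n + 1) : ℝ) : ℂ) * Complex.I by push_cast; ring, he,
    norm_mul, norm_mul, Complex.norm_exp_ofReal_mul_I, Complex.norm_I, Complex.norm_real,
    Real.norm_of_nonneg (by positivity), one_mul, mul_one]

theorem prod_two_mul_sin_half_range (m : ℕ) :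
    ∏ k ∈ Finset.range m, (2 * Real.sin (Real.pi * (k + 1) / (2 * m + 1))) = √(2 * m + 1) := by
  symm
  rw [Real.sqrt_eq_iff_eq_sq (by positivity)]
  · have h := prod_two_mul_sin_range (2 * m)
    rw [two_mul m, Finset.prod_range_add, ← Finset.prod_range_reflect _ m] at h
    rw [sq, ← Finset.prod_mul_distrib]
    push_cast at h
    rw [← two_mul, ← Finset.prod_mul_distrib] at h
    refine h.symm.trans (Eq.trans (Finset.prod_congr rfl fun k hk => ?_)
      (Finset.prod_range_reflect _ m))
    have hk' : m - 1 - k + 1 = m - k ∧ k ≤ m := by have := Finset.mem_range.mp hk; omega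
    congr 2
    rw [← Real.sin_pi_sub]
    congr 1
    have hc : ((m - 1 - k : ℕ) : ℝ) + 1 = m - k := by
      rw [← Nat.cast_add_one, hk'.1, Nat.cast_sub hk'.2]
    rw [hc]
    field_simp
    ring
  · refine Finset.prod_nonneg fun k hk =>
      mul_nonneg zero_le_two (Real.sin_nonneg_of_nonneg_of_le_pi (by positivity) ?_)
    rw [div_le_iff₀ (by positivity)]
    have : (k : ℝ) + 1 ≤ m := by exact_mod_cast Finset.mem_range.mp hk
    gcongr
    linarith

open Complex in
theorem prod_exp_pow_sub_one (m : ℕ) :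
    ∏ k ∈ Finset.range m, (exp (2 * Real.pi * I / (2 * m + 1 : ℕ)) ^ (k + 1) - 1) =
      (-1) ^ (∑ k ∈ Finset.range m, (k + 1)) *
        exp (2 * Real.pi * I / (2 * m + 1 : ℕ)) ^ ((m + 1) * ∑ k ∈ Finset.range m, (k + 1)) *
        (I ^ m * √(2 * m + 1 : ℕ)) := by
  set ζ := exp (2 * Real.pi * I / (2 * m + 1 : ℕ)) with hζ
  have hn : ((2 * m + 1 : ℕ) : ℂ) ≠ 0 := Nat.cast_ne_zero.mpr (by omega)
  have hω : exp (Real.pi * I / (2 * m + 1 : ℕ)) = -1 * ζ ^ (m + 1) := by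
    rw [← exp_pi_mul_I, hζ, ← Complex.exp_nat_mul, ← Complex.exp_add,
      Complex.exp_eq_exp_iff_exists_int]
    refine ⟨-1, ?_⟩
    field_simp
    push_cast
    ring
  have hterm (k : ℕ) : ζ ^ (k + 1) - 1 = (-1 * ζ ^ (m + 1)) ^ (k + 1) *
      ((2 * Real.sin (Real.pi * (k + 1) / (2 * m + 1)) : ℝ) * I) := by
    rw [← hω, hζ, ← Complex.exp_nat_mul, ← Complex.exp_nat_mul, ← mul_assoc]
    convert exp_two_mul_I_sub_one (Real.pi * (k + 1) / (2 * m + 1)) using 3 <;>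
    · push_cast
      ring_nf
  simp_rw [hterm]
  rw [Finset.prod_mul_distrib, Finset.prod_mul_distrib, Finset.prod_pow_eq_pow_sum, mul_pow,
    ← pow_mul, ← Complex.ofReal_prod, prod_two_mul_sin_half_range, Finset.prod_const,
    Finset.card_range]
  push_cast
  ring

/-- The Gauss sum of the Legendre symbol modulo `p`. -/
noncomputable def quadraticGaussSum (p : ℕ) [Fact p.Prime] : ℂ :=
  gaussSum ((quadraticChar (ZMod p)).ringHomComp (Int.castRingHom ℂ)) ZMod.stdAddChar

theorem quadraticGaussSum_sq (p : ℕ) [Fact p.Prime] (hp : p ≠ 2) :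
    quadraticGaussSum p ^ 2 = (-1) ^ (p / 2) * p := by
  have hc : ringChar (ZMod p) ≠ 2 := by rwa [ZMod.ringChar_zmod_n]
  have h1 := ((quadraticChar_isQuadratic (ZMod p)).comp (Int.castRingHom ℂ))
  have h2 : (quadraticChar (ZMod p)).ringHomComp (Int.castRingHom ℂ) ≠ 1 :=
    (MulChar.ringHomComp_ne_one_iff (RingHom.injective_int _)).mpr (quadraticChar_ne_one hc)
  rw [quadraticGaussSum, gaussSum_sq h2 h1 (ZMod.isPrimitive_stdAddChar p), ZMod.card,
    MulChar.ringHomComp_apply, quadraticChar_neg_one hc, ZMod.card,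
    ZMod.χ₄_eq_neg_one_pow ((Nat.Prime.mod_two_eq_one_iff_ne_two Fact.out).mpr hp)]
  simp

open Complex in
theorem quadraticGaussSum_eq_sum_range (p : ℕ) [Fact p.Prime] :
    quadraticGaussSum p =
      ∑ j ∈ Finset.range p, (legendreSym p j : ℂ) * exp (2 * Real.pi * I / p) ^ j := by
  refine Finset.sum_nbij' ZMod.val (fun j => (j : ZMod p)) (by simp [ZMod.val_lt]) (by simp)
    (by simp) (fun j hj => ZMod.val_cast_of_lt (Finset.mem_range.mp hj)) fun a _ => ?_
  rw [MulChar.ringHomComp_apply, legendreSym, ZMod.stdAddChar_apply, ZMod.toCircle_apply,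
    ← Complex.exp_nat_mul]
  simp only [Int.cast_natCast, ZMod.natCast_zmod_val, eq_intCast]
  congr 2
  ring

open Polynomial in
theorem sign_eq_of_quadraticGaussSum_eq (p : ℕ) [Fact p.Prime] (m : ℕ) (hm : p = 2 * m + 1)
    (δ : ℤ) (hδ : quadraticGaussSum p = δ * (Complex.I ^ m * √p)) :
    (δ : ZMod p) = (-1) ^ (∑ k ∈ Finset.range m, (k + 1) + m) := by
  have hp : p.Prime := Fact.out
  set S := ∑ k ∈ Finset.range m, (k + 1) with hS
  set ζ := Complex.exp (2 * Real.pi * Complex.I / p) with hζ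
  have hprim : IsPrimitiveRoot ζ p := Complex.isPrimitiveRoot_exp p hp.ne_zero
  let P : ℤ[X] := (-1) ^ S * X ^ ((m + 1) * S) *
    (∑ j ∈ Finset.range p, C (legendreSym p j) * X ^ j) -
      C δ * ∏ k ∈ Finset.range m, (X ^ (k + 1) - 1)
  have hprod := prod_exp_pow_sub_one m
  rw [← hm, ← hζ, ← hS] at hprod
  have hP : aeval ζ P = 0 := by
    simp only [P, map_sub, map_mul, map_pow, map_neg, map_one, aeval_X, map_sum, map_prod, eq_intCast,
      map_intCast]
    rw [hprod, ← quadraticGaussSum_eq_sum_range, hδ]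
    ring
  have hdvd : cyclotomic p ℤ ∣ P := by
    rw [cyclotomic_eq_minpoly hprim hp.pos]
    exact minpoly.isIntegrallyClosed_dvd (hprim.isIntegral hp.pos) hP
  obtain ⟨B, hB, hB1⟩ := exists_sum_pow_mul_X_pow_eq p m (by omega)
  obtain ⟨D, hD, hD1⟩ := exists_prod_X_pow_sub_one_eq (ZMod p) m
  have hX : (X - 1 : (ZMod p)[X]) ≠ 0 := by simpa using X_sub_C_ne_zero (1 : ZMod p)
  have hmap : P.map (Int.castRingHom (ZMod p)) =
      (X - 1) ^ m * ((-1) ^ S * X ^ ((m + 1) * S) * B - C (δ : ZMod p) * D) := by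
    have hsum : ∑ j ∈ Finset.range p, C ((legendreSym p j : ℤ) : ZMod p) * X ^ j =
        (X - 1) ^ m * B := by
      rw [show m = p - 1 - m by omega, ← hB]
      refine Finset.sum_congr rfl fun j _ => ?_
      rw [legendreSym.eq_pow, show p / 2 = m by omega, Int.cast_natCast]
    simp only [P, Polynomial.map_sub, Polynomial.map_mul, Polynomial.map_pow, Polynomial.map_neg,
      Polynomial.map_one, map_X, Polynomial.map_sum, Polynomial.map_prod, map_C,
      eq_intCast (Int.castRingHom (ZMod p))]
    rw [hsum, hD]
    ring
  have hdvd' := Polynomial.map_dvd (Int.castRingHom (ZMod p)) hdvd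
  rw [map_cyclotomic, cyclotomic_self_zmod, hmap, show p - 1 = m + m by omega, pow_add,
    mul_dvd_mul_iff_left (pow_ne_zero _ hX)] at hdvd'
  have hroot : ((-1) ^ S * X ^ ((m + 1) * S) * B - C (δ : ZMod p) * D).IsRoot 1 := by
    rw [← dvd_iff_isRoot, C_1]
    exact (dvd_pow_self _ (by have := hp.two_le; omega)).trans hdvd'
  simp only [IsRoot, eval_sub, eval_mul, eval_pow, eval_neg, eval_one, eval_X, one_pow, eval_C,
    hB1, hD1, mul_one] at hroot
  have hfac : (m.factorial : ZMod p) ≠ 0 := by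
    rw [Ne, ZMod.natCast_eq_zero_iff, hp.dvd_factorial]
    omega
  rw [pow_add]
  refine mul_right_cancel₀ hfac ?_
  linear_combination -hroot

theorem neg_one_pow_sum_range_add (m : ℕ) :
    ((-1) ^ (∑ k ∈ Finset.range m, (k + 1) + m) * Complex.I ^ m : ℂ) =
      if (2 * m + 1) % 4 = 1 then 1 else Complex.I := by
  induction m using Nat.twoStepInduction with
  | zero => simp
  | one => simp
  | more m ih _ =>
    rw [show (2 * (m + 2) + 1) % 4 = (2 * m + 1) % 4 by omega, ← ih, Finset.sum_range_succ,
      Finset.sum_range_succ, pow_add Complex.I, Complex.I_sq,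
      show ∑ k ∈ Finset.range m, (k + 1) + (m + 1) + (m + 1 + 1) + (m + 2) =
        (∑ k ∈ Finset.range m, (k + 1) + m) + (2 * (m + 2) + 1) by ring, pow_add (-1 : ℂ),
      Odd.neg_one_pow (n := 2 * (m + 2) + 1) ⟨_, rfl⟩]
    ring

/-- **Gauss**: the sign of the quadratic Gauss sum modulo an odd prime. -/
theorem quadraticGaussSum_eq (p : ℕ) [Fact p.Prime] (hp : p ≠ 2) :
    quadraticGaussSum p = (if p % 4 = 1 then 1 else Complex.I) * √p := by
  obtain ⟨m, hm⟩ := (Fact.out : p.Prime).odd_of_ne_two hp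
  have hsq : quadraticGaussSum p ^ 2 = (Complex.I ^ m * √p) ^ 2 := by
    rw [quadraticGaussSum_sq p hp, mul_pow, ← pow_mul, mul_comm m 2, pow_mul, Complex.I_sq,
      ← Complex.ofReal_pow, Real.sq_sqrt (Nat.cast_nonneg p), Complex.ofReal_natCast,
      show p / 2 = m by omega]
  obtain ⟨δ, hδ, hδ1⟩ : ∃ δ : ℤ, quadraticGaussSum p = δ * (Complex.I ^ m * √p) ∧
      (δ = 1 ∨ δ = -1) := by
    rcases sq_eq_sq_iff_eq_or_eq_neg.mp hsq with h | h
    · exact ⟨1, by simpa using h, .inl rfl⟩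
    · exact ⟨-1, by simpa using h, .inr rfl⟩
  have hsign := sign_eq_of_quadraticGaussSum_eq p m hm δ hδ
  have hδ2 : δ = (-1) ^ (∑ k ∈ Finset.range m, (k + 1) + m) := by
    have : Fact (2 < p) := ⟨by have := (Fact.out : p.Prime).two_le; omega⟩
    have hne := ZMod.neg_one_ne_one (n := p)
    replace hsign : (δ : ZMod p) =
        (((-1) ^ (∑ k ∈ Finset.range m, (k + 1) + m) : ℤ) : ZMod p) := by
      push_cast at hsign ⊢
      exact hsign
    rcases neg_one_pow_eq_or ℤ (∑ k ∈ Finset.range m, (k + 1) + m) with h | h <;>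
    · rw [h] at hsign ⊢
      rcases hδ1 with rfl | rfl <;>
        first
        | rfl
        | exact absurd (by simpa using hsign) hne
        | exact absurd (by simpa using hsign.symm) hne
  rw [hδ, hδ2, hm, ← neg_one_pow_sum_range_add]
  push_cast
  ring

theorem sum_addChar_sq {F : Type*} [Field F] [Fintype F] [DecidableEq F] (hF : ringChar F ≠ 2)
    {φ : AddChar F ℂ} (hφ : φ ≠ 1) :
    ∑ c, φ (c ^ 2) = gaussSum ((quadraticChar F).ringHomComp (Int.castRingHom ℂ)) φ := by
  rw [← Finset.sum_fiberwise Finset.univ (fun c : F => c ^ 2), gaussSum]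
  calc _ = ∑ b, ((quadraticChar F b : ℂ) + 1) * φ b := Finset.sum_congr rfl fun b _ => ?_
    _ = _ := by simp [add_mul, Finset.sum_add_distrib, AddChar.sum_eq_zero_of_ne_one hφ]
  have h := quadraticChar_card_sqrts hF b
  rw [Finset.sum_congr rfl (g := fun _ => φ b) (by simp +contextual), Finset.sum_const,
    nsmul_eq_mul]
  congr 1
  have h' : (Finset.univ.filter fun c : F => c ^ 2 = b) = {x : F | x ^ 2 = b}.toFinset := by
    ext; simp
  rw [h']
  exact_mod_cast h

theorem sum_stdAddChar_mul_sq (p : ℕ) [Fact p.Prime] (hp : p ≠ 2) {a : ZMod p} (ha : a ≠ 0) :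
    ∑ c : ZMod p, ZMod.stdAddChar (a * c ^ 2) =
      (quadraticChar (ZMod p) a : ℂ) * quadraticGaussSum p := by
  have hc : ringChar (ZMod p) ≠ 2 := by rwa [ZMod.ringChar_zmod_n]
  have h := sum_addChar_sq hc (ZMod.isPrimitive_stdAddChar p ha)
  have h2 := gaussSum_mulShift_eq ((quadraticChar (ZMod p)).ringHomComp (Int.castRingHom ℂ))
    ZMod.stdAddChar (Units.mk0 a ha)
  rw [((quadraticChar_isQuadratic (ZMod p)).comp (Int.castRingHom ℂ)).inv, Units.val_mk0] at h2
  rw [h2] at h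
  exact h

open Matrix in
/-- The discriminant of a finite field extension of `𝔽_p` of degree `n` is a square in `𝔽_p` if and
only if `n` is odd. -/
theorem quadraticChar_discr {p : ℕ} [Fact p.Prime] (hp : p ≠ 2) {F : Type*} [Field F] [Fintype F]
    [Algebra (ZMod p) F] {n : ℕ} (b : Module.Basis (Fin n) (ZMod p) F) :
    quadraticChar (ZMod p) (Algebra.discr (ZMod p) b) = (-1) ^ (n - 1) := by
  have hc : ringChar (ZMod p) ≠ 2 := by rwa [ZMod.ringChar_zmod_n]
  have : Fact (2 < p) := ⟨by have := (Fact.out : p.Prime).two_le; omega⟩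
  have := charP_of_injective_algebraMap (algebraMap (ZMod p) F).injective p
  have hn : Module.finrank (ZMod p) F = n := by simpa using Module.finrank_eq_card_basis b
  let M : Matrix (Fin n) (Fin n) F := Matrix.of fun i j => b j ^ p ^ (i : ℕ)
  have hM : algebraMap (ZMod p) F (Algebra.discr (ZMod p) b) = M.det ^ 2 := by
    rw [sq]
    nth_rw 1 [← M.det_transpose]
    rw [← Matrix.det_mul, Algebra.discr_def, RingHom.map_det]
    congr 1
    ext i j
    rw [RingHom.mapMatrix_apply, Matrix.map_apply, Algebra.traceMatrix_apply,
      Algebra.traceForm_apply, FiniteField.algebraMap_trace_eq_sum_pow, hn, Finset.sum_range,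
      Matrix.mul_apply]
    simp [M, mul_pow]
  have hF : M.det ^ p = (-1) ^ (n - 1) * M.det := by
    rw [← frobenius_def, RingHom.map_det]
    have : (frobenius F p).mapMatrix M = M.submatrix (finRotate n) id := by
      ext i j
      simp only [M, RingHom.mapMatrix_apply, map_apply, of_apply, frobenius_def, submatrix_apply,
        id, ← pow_mul, ← pow_succ]
      rcases n with _ | n
      · exact i.elim0
      · by_cases hi : i = Fin.last n
        · have h := FiniteField.pow_card (b j)
          rw [Module.card_eq_pow_finrank (K := ZMod p), hn, ZMod.card] at h
          rw [hi, finRotate_last, Fin.val_last, Fin.val_zero, h, pow_zero, pow_one]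
        · rw [coe_finRotate_of_ne_last hi]
    rw [this, det_permute, sign_finRotate]
    simp
  have hD : M.det ≠ 0 := by
    have h := Algebra.discr_not_zero_of_basis (ZMod p) b
    intro h0
    rw [h0] at hM
    exact h (by simpa using hM)
  have hpow : M.det ^ (p - 1) = (-1) ^ (n - 1) := by
    refine mul_right_cancel₀ hD ?_
    rw [← pow_succ, Nat.sub_add_cancel (Fact.out : p.Prime).one_le, hF]
  have he := congrArg (algebraMap (ZMod p) F)
    (quadraticChar_eq_pow_of_char_ne_two' hc (Algebra.discr (ZMod p) b))
  rw [map_pow, hM, ← pow_mul, ZMod.card, show 2 * (p / 2) = p - 1 by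
    have := (Nat.Prime.mod_two_eq_one_iff_ne_two Fact.out).mpr hp; omega, hpow] at he
  have he' : ((quadraticChar (ZMod p) (Algebra.discr (ZMod p) b) : ℤ) : ZMod p) =
      (((-1) ^ (n - 1) : ℤ) : ZMod p) := by
    apply (algebraMap (ZMod p) F).injective
    simpa using he
  have hne := ZMod.neg_one_ne_one (n := p)
  rcases quadraticChar_dichotomy (Algebra.discr_not_zero_of_basis (ZMod p) b) with h1 | h1 <;>
  rcases neg_one_pow_eq_or ℤ (n - 1) with h | h <;>
  · rw [h1, h] at he' ⊢
    try first
    | exact absurd (by simpa using he') hne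
    | exact absurd (by simpa using he'.symm) hne

theorem AddChar.map_sum_eq_prod {A M ι : Type*} [AddCommMonoid A] [CommMonoid M]
    (ψ : AddChar A M) (s : Finset ι) (g : ι → A) : ψ (∑ i ∈ s, g i) = ∏ i ∈ s, ψ (g i) :=
  map_prod ψ.toMonoidHom (fun i => Multiplicative.ofAdd (g i)) s

theorem sum_stdAddChar_trace_sq {p : ℕ} [Fact p.Prime] (hp : p ≠ 2) (F : Type*) [Field F]
    [Fintype F] [Algebra (ZMod p) F] :
    ∑ x : F, ZMod.stdAddChar (Algebra.trace (ZMod p) F (x ^ 2)) =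
      (-1) ^ (Module.finrank (ZMod p) F - 1) *
        quadraticGaussSum p ^ Module.finrank (ZMod p) F := by
  classical
  have h2 : (2 : ZMod p) ≠ 0 := Ring.two_ne_zero (by rwa [ZMod.ringChar_zmod_n])
  have : Invertible (2 : ZMod p) := invertibleOfNonzero h2
  obtain ⟨v, hv⟩ := LinearMap.BilinForm.exists_orthogonal_basis
    (B := Algebra.traceForm (ZMod p) F) ⟨(Algebra.traceForm_isSymm (ZMod p)).eq⟩
  have hdiag : Algebra.traceMatrix (ZMod p) v =
      Matrix.diagonal fun i => Algebra.trace (ZMod p) F (v i * v i) := by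
    ext i j
    rw [Algebra.traceMatrix_apply, Matrix.diagonal_apply]
    split_ifs with h
    · rw [h, Algebra.traceForm_apply]
    · exact hv h
  have hdiscr : Algebra.discr (ZMod p) v = ∏ i, Algebra.trace (ZMod p) F (v i * v i) := by
    rw [Algebra.discr_def, hdiag, Matrix.det_diagonal]
  have hne (i) : Algebra.trace (ZMod p) F (v i * v i) ≠ 0 :=
    Finset.prod_ne_zero_iff.mp (hdiscr ▸ Algebra.discr_not_zero_of_basis (ZMod p) v) i
      (Finset.mem_univ i)
  have hsq (c : Fin (Module.finrank (ZMod p) F) → ZMod p) :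
      Algebra.trace (ZMod p) F (v.equivFun.symm c ^ 2) =
      ∑ i, Algebra.trace (ZMod p) F (v i * v i) * c i ^ 2 := by
    rw [v.equivFun_symm_apply, sq, Finset.sum_mul_sum, map_sum]
    refine Finset.sum_congr rfl fun i _ => ?_
    rw [map_sum, Finset.sum_eq_single i]
    · rw [smul_mul_smul_comm, map_smul, smul_eq_mul, sq, mul_comm]
    · intro j _ hji
      have : Algebra.trace (ZMod p) F (v i * v j) = 0 := hv hji.symm
      rw [smul_mul_smul_comm, map_smul, this, smul_zero]
    · simp
  calc _ = ∑ c : Fin (Module.finrank (ZMod p) F) → ZMod p,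
        ∏ i, (ZMod.stdAddChar (Algebra.trace (ZMod p) F (v i * v i) * c i ^ 2) : ℂ) := by
        rw [← v.equivFun.symm.toEquiv.sum_comp]
        refine Finset.sum_congr rfl fun c _ => ?_
        rw [← AddChar.map_sum_eq_prod, ← hsq]
        rfl
    _ = ∏ i, ∑ c : ZMod p,
        (ZMod.stdAddChar (Algebra.trace (ZMod p) F (v i * v i) * c ^ 2) : ℂ) := by
        rw [Finset.prod_univ_sum, Fintype.piFinset_univ]
    _ = (quadraticChar (ZMod p) (Algebra.discr (ZMod p) v) : ℂ) *
          quadraticGaussSum p ^ Module.finrank (ZMod p) F := by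
        simp_rw [sum_stdAddChar_mul_sq p hp (hne _), Finset.prod_mul_distrib, hdiscr, map_prod]
        simp
    _ = _ := by rw [quadraticChar_discr hp]; simp

theorem MulChar.eq_quadraticChar_of_orderOf_eq_two {F : Type*} [Field F] [Fintype F]
    [DecidableEq F] {η : MulChar F ℂ} (h : orderOf η = 2) :
    η = (quadraticChar F).ringHomComp (Int.castRingHom ℂ) := by
  have hsq : η ^ 2 = 1 := h ▸ pow_orderOf_eq_one η
  have hval (a : F) (ha : a ≠ 0) : η a ^ 2 = 1 := by
    rw [← MulChar.pow_apply' η two_ne_zero, hsq, MulChar.one_apply ha.isUnit]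
  have hne : η ≠ 1 := fun h1 => by simp [h1] at h
  obtain ⟨u, hu⟩ := MulChar.ne_one_iff.mp hne
  have hF : ringChar F ≠ 2 := by
    intro hF
    obtain ⟨c, hc⟩ := FiniteField.isSquare_of_char_two hF (u : F)
    have hc0 : c ≠ 0 := fun h0 => u.ne_zero (by simp [hc, h0])
    exact hu (by rw [hc, map_mul, ← sq, hval c hc0])
  have key (a : F) (ha : a ≠ 0) (hs : IsSquare a) : η a = 1 := by
    obtain ⟨c, rfl⟩ := hs
    rw [map_mul, ← sq, hval c (left_ne_zero_of_mul ha)]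
  have husq : ¬ IsSquare (u : F) := fun hs => hu (key _ u.ne_zero hs)
  have hu' : η u = -1 :=
    (mul_self_eq_one_iff.mp (by rw [← sq, hval u u.ne_zero])).resolve_left hu
  ext a
  have ha := a.ne_zero
  rw [MulChar.ringHomComp_apply]
  by_cases hs : IsSquare (a : F)
  · rw [key _ ha hs, (quadraticChar_one_iff_isSquare ha).mpr hs, map_one]
  · have hm := (quadraticChar_neg_one_iff_not_isSquare).mpr hs
    have hmu := (quadraticChar_neg_one_iff_not_isSquare).mpr husq
    have hua : IsSquare ((a : F) * u) := by
      rw [← quadraticChar_one_iff_isSquare (mul_ne_zero ha u.ne_zero), map_mul, hm, hmu]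
      norm_num
    have := key _ (mul_ne_zero ha u.ne_zero) hua
    rw [map_mul, hu'] at this
    rw [hm, map_neg, map_one]
    linear_combination -this

/-- Evaluation of the quadratic Gauss sum over `F_{p^f}` (Gauss). -/
theorem stmt_1 (p : ℕ) [Fact p.Prime] (hp2 : p ≠ 2) (f : ℕ) (hf : 0 < f)
    (F : Type*) [Field F] [Fintype F] [Algebra (ZMod p) F]
    (hcard : Fintype.card F = p ^ f)
    (η : MulChar F ℂ) (hord : orderOf η = 2) :
    (∑ x : F, Complex.exp (2 * Real.pi * Complex.I *
        ((Algebra.trace (ZMod p) F x).val : ℂ) / p) * η x) =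
      (if p % 4 = 1 then ((-1 : ℂ)) ^ (f - 1)
        else ((-1 : ℂ)) ^ (f - 1) * Complex.I ^ f) * ((Real.sqrt p : ℂ)) ^ f := by
  classical
  have hc : ringChar F ≠ 2 := by
    have := charP_of_injective_algebraMap (algebraMap (ZMod p) F).injective p
    rwa [ringChar.eq F p]
  have hfin : Module.finrank (ZMod p) F = f := by
    have h := Module.card_eq_pow_finrank (K := ZMod p) (V := F)
    rw [hcard, ZMod.card] at h
    exact (Nat.pow_right_injective (Fact.out : p.Prime).two_le h).symm
  let φ : AddChar F ℂ := (ZMod.stdAddChar (N := p)).compAddMonoidHom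
    (Algebra.trace (ZMod p) F).toAddMonoidHom
  have hφ : φ ≠ 1 := by
    obtain ⟨x, hx⟩ := Algebra.trace_surjective (ZMod p) F 1
    have h1 := ZMod.isPrimitive_stdAddChar p (one_ne_zero (α := ZMod p))
    rw [AddChar.mulShift_one, AddChar.zmod_char_ne_one_iff] at h1
    exact AddChar.ne_one_iff.mpr ⟨x, by simpa [φ, hx] using h1⟩
  have hsum := sum_addChar_sq hc hφ
  rw [← MulChar.eq_quadraticChar_of_orderOf_eq_two hord] at hsum
  calc _ = gaussSum η φ := Finset.sum_congr rfl fun x _ => by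
        rw [mul_comm, ← ZMod.toCircle_apply, ← ZMod.stdAddChar_apply]
        rfl
    _ = (-1) ^ (f - 1) * quadraticGaussSum p ^ f := by
        rw [← hsum, ← hfin, ← sum_stdAddChar_trace_sq hp2 F]
        rfl
    _ = _ := by
        rw [quadraticGaussSum_eq p hp2]
        split_ifs
        · rw [one_mul]
        · rw [mul_pow, mul_assoc]
end

section
/- Let p ≡ 3 (mod 4) be a prime, h an odd positive integer, and G = (F_{p^h}, +). Let D ⊆ F_{p^h} \ {0} with |D| = (p^h - 1)/2, D ∩ (-D) = ∅, D invariant under multiplication by x² for every x ∈ F_p^*. If for every nontrivial additive character ψ of F_{p^h}, the integer combination 2·ψ(D) + 1 is divisible by p^{(h-1)/2} (as an algebraic integer in Z[ζ_p]), then D is a skew Hadamard difference set in G. -/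
open Finset

theorem Rat.exists_intCast_eq_of_isIntegral_complex {r : ℚ} (hr : IsIntegral ℤ (r : ℂ)) :
    ∃ k : ℤ, (k : ℚ) = r := by
  have h : IsIntegral ℤ r :=
    (isIntegral_algebraMap_iff (B := ℂ) (algebraMap ℚ ℂ).injective).1 (by simpa using hr)
  simpa using IsIntegrallyClosed.isIntegral_iff.1 h

theorem two_mul_add_one_ne_zero_of_isIntegral {z : ℂ} (hz : IsIntegral ℤ z) : 2 * z + 1 ≠ 0 := by
  intro h
  have hz' : z = ((-1 / 2 : ℚ) : ℂ) := by
    push_cast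
    linear_combination h / 2
  obtain ⟨k, hk⟩ := Rat.exists_intCast_eq_of_isIntegral_complex (hz' ▸ hz)
  have : (2 * k : ℚ) = -1 := by rw [hk]; norm_num
  norm_cast at this
  lia

/-- An algebraic integer in `ℚ · √-p` squares to `-p` times the square of an integer. -/
theorem exists_int_sq_eq_neg_prime_mul_sq {p : ℕ} (hp : p.Prime) {α G : ℂ} {s : ℚ}
    (hα : IsIntegral ℤ α) (hG : G ^ 2 = -p) (hs : α = s * G) :
    ∃ t : ℤ, α ^ 2 = -(p * t ^ 2) := by
  have hp0 : (p : ℚ) ≠ 0 := mod_cast hp.ne_zero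
  have hGi : IsIntegral ℤ G := by
    refine IsIntegral.of_pow two_pos ?_
    rw [hG]
    exact_mod_cast isIntegral_algebraMap (R := ℤ) (A := ℂ) (x := -(p : ℤ))
  obtain ⟨k, hk⟩ := Rat.exists_intCast_eq_of_isIntegral_complex (r := -(p * s)) <| by
    have h : α * G = (-(p * s) : ℚ) := by
      rw [hs]
      push_cast
      linear_combination s * hG
    exact h ▸ hα.mul hGi
  obtain ⟨m, hm⟩ := Rat.exists_intCast_eq_of_isIntegral_complex (r := -(p * s ^ 2)) <| by
    have h : α ^ 2 = (-(p * s ^ 2) : ℚ) := by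
      rw [hs]
      push_cast
      linear_combination s ^ 2 * hG
    exact h ▸ hα.pow 2
  have hkm : k ^ 2 = p * -m := by
    have : (k ^ 2 : ℚ) = p * -m := by
      rw [hk, hm]
      ring
    exact_mod_cast this
  obtain ⟨t, rfl⟩ := (Nat.prime_iff_prime_int.1 hp).dvd_of_dvd_pow ⟨_, hkm⟩
  refine ⟨t, ?_⟩
  have hst : s = -t := by
    have : (p : ℚ) * t = p * -s := by
      push_cast at hk
      linarith
    linarith [mul_left_cancel₀ hp0 this]
  rw [hs, hst, mul_pow, hG]
  push_cast
  ring

theorem AddChar.isIntegral_apply {F : Type*} [AddCommGroup F] [Finite F] (ψ : AddChar F ℂ) (x : F) :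
    IsIntegral ℤ (ψ x) := by
  refine IsIntegral.of_pow (Nat.card_pos (α := F)) ?_
  rw [← AddChar.map_nsmul_eq_pow, card_nsmul_eq_zero', AddChar.map_zero_eq_one]
  exact isIntegral_one

/-- Orthogonality of characters, counting the representations of `g` as a difference. -/
theorem AddChar.sum_mul_sum_neg_mul_eq_card {F : Type*} [AddCommGroup F] [Fintype F] [DecidableEq F]
    (D : Finset F) (g : F) :
    ∑ ψ : AddChar F ℂ, (∑ d ∈ D, ψ d) * (∑ d ∈ D, ψ (-d)) * ψ (-g) =
      Fintype.card F * #{z ∈ D ×ˢ D | z.1 - z.2 = g} := by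
  simp_rw [sum_mul_sum, sum_mul, ← AddChar.map_add_eq_mul]
  rw [sum_comm]
  simp_rw [sum_comm (s := univ), AddChar.sum_apply_eq_ite]
  rw [← sum_product' (f := fun a b ↦ if a + -b + -g = 0 then (Fintype.card F : ℂ) else 0),
    ← sum_filter, sum_const, nsmul_eq_mul, mul_comm]
  congr 3
  ext z
  simp [← sub_eq_add_neg, sub_eq_zero]

theorem disjoint_image_neg_of_skew {F : Type*} [AddCommGroup F] [DecidableEq F] {D : Finset F}
    (hskew : ∀ x ∈ D, -x ∉ D) : Disjoint D (D.image (-·)) := by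
  rw [disjoint_left]
  intro x hx h
  obtain ⟨y, hy, rfl⟩ := mem_image.1 h
  exact hskew y hy hx

section

variable {F : Type*} [Fintype F] [DecidableEq F]

theorem mem_or_neg_mem_of_card [AddCommGroup F] {D : Finset F} (h0 : (0 : F) ∉ D)
    (hcard : 2 * #D + 1 = Fintype.card F) (hskew : ∀ x ∈ D, -x ∉ D) {x : F} (hx : x ≠ 0) :
    x ∈ D ∨ -x ∈ D := by
  have hdisj := disjoint_image_neg_of_skew hskew
  have hsub : D ∪ D.image (-·) ⊆ univ.erase 0 := by
    intro x hx
    simp only [mem_erase, mem_univ, and_true]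
    rintro rfl
    simp [h0] at hx
  have heq := eq_of_subset_of_card_le hsub <| by
    rw [card_union_of_disjoint hdisj, card_image_of_injective _ neg_injective,
      card_erase_of_mem (mem_univ _), card_univ]
    lia
  have : x ∈ D ∪ D.image (-·) := by simp [heq, hx]
  simpa [neg_eq_iff_eq_neg] using this

theorem sum_add_sum_neg_eq_neg_one [Field F] {D : Finset F} (h0 : (0 : F) ∉ D)
    (hskew : ∀ x ∈ D, -x ∉ D) (htot : ∀ x : F, x ≠ 0 → x ∈ D ∨ -x ∈ D)
    {ψ : AddChar F ℂ} (hψ : ψ ≠ 1) :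
    ∑ d ∈ D, ψ d + ∑ d ∈ D, ψ (-d) = -1 := by
  have hdisj := disjoint_image_neg_of_skew hskew
  have heq : univ.erase 0 = D ∪ D.image (-·) := by
    ext x
    by_cases hx : x = 0
    · simp [hx, h0]
    · simpa [hx, neg_eq_iff_eq_neg] using htot x hx
  have h := AddChar.sum_eq_zero_of_ne_one hψ
  rw [← add_sum_erase _ _ (mem_univ (0 : F)), heq, sum_union hdisj,
    sum_image neg_injective.injOn, AddChar.map_zero_eq_one] at h
  linear_combination h

end

section

variable {p : ℕ} [Fact p.Prime]

theorem ZMod.ringChar_ne_two_of_mod_four (hp : p % 4 = 3) : ringChar (ZMod p) ≠ 2 := by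
  rw [ZMod.ringChar_zmod_n]
  lia

theorem ZMod.quadraticChar_neg_one_of_mod_four (hp : p % 4 = 3) :
    quadraticChar (ZMod p) (-1) = -1 := by
  rw [quadraticChar_neg_one (ZMod.ringChar_ne_two_of_mod_four hp), ZMod.card,
    ZMod.χ₄_nat_three_mod_four hp]

/-- The quadratic character of `ZMod p` with complex values. -/
noncomputable def ZMod.complexQuadraticChar (p : ℕ) [Fact p.Prime] : MulChar (ZMod p) ℂ :=
  (quadraticChar (ZMod p)).ringHomComp (Int.castRingHom ℂ)

theorem ZMod.complexQuadraticChar_apply (a : ZMod p) :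
    ZMod.complexQuadraticChar p a = (quadraticChar (ZMod p) a : ℂ) := rfl

theorem ZMod.complexQuadraticChar_ne_one (hp : p % 4 = 3) : ZMod.complexQuadraticChar p ≠ 1 :=
  (MulChar.ringHomComp_ne_one_iff (Int.castRingHom ℂ).injective_int).2
    (quadraticChar_ne_one (ZMod.ringChar_ne_two_of_mod_four hp))

/-- The quadratic Gauss sums over `ZMod p` are integral multiples of a fixed root of `-p`. -/
theorem ZMod.exists_gaussSum_eq_int_mul (hp : p % 4 = 3) {G : ℂ} (hG : G ^ 2 = -p)
    (φ : AddChar (ZMod p) ℂ) :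
    ∃ n : ℤ, gaussSum (ZMod.complexQuadraticChar p) φ = n * G := by
  have hχ := ZMod.complexQuadraticChar_ne_one hp
  by_cases hφ : φ = 1
  · exact ⟨0, by simp [hφ, gaussSum_one_right hχ]⟩
  · have h := gaussSum_sq hχ ((quadraticChar_isQuadratic (ZMod p)).comp _)
      (AddChar.IsPrimitive.of_ne_one hφ)
    rw [ZMod.complexQuadraticChar_apply, ZMod.quadraticChar_neg_one_of_mod_four hp, ZMod.card,
      Int.cast_neg, Int.cast_one, neg_one_mul, ← hG, sq_eq_sq_iff_eq_or_eq_neg] at h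
    obtain h | h := h
    · exact ⟨1, by simp [h]⟩
    · exact ⟨-1, by simp [h]⟩

variable {F : Type*} [Field F] [Algebra (ZMod p) F] [DecidableEq F]

theorem sum_sq_mul_eq_sum {D : Finset F}
    (hinv : ∀ c : ZMod p, c ≠ 0 → ∀ d ∈ D, (algebraMap (ZMod p) F c) ^ 2 * d ∈ D)
    (f : F → ℂ) {c : ZMod p} (hc : c ≠ 0) :
    ∑ d ∈ D, f (algebraMap (ZMod p) F c ^ 2 * d) = ∑ d ∈ D, f d := by
  have hinj : Function.Injective (algebraMap (ZMod p) F c ^ 2 * ·) :=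
    mul_right_injective₀ (pow_ne_zero 2 (by simpa using hc))
  have himage : D.image (algebraMap (ZMod p) F c ^ 2 * ·) = D :=
    eq_of_subset_of_card_le (image_subset_iff.2 (hinv c hc))
      (card_image_of_injective _ hinj).ge
  conv_rhs => rw [← himage, sum_image hinj.injOn]

theorem two_mul_sum_mul_add_one (hp : p % 4 = 3) {D : Finset F}
    (hinv : ∀ c : ZMod p, c ≠ 0 → ∀ d ∈ D, (algebraMap (ZMod p) F c) ^ 2 * d ∈ D)
    {ψ : AddChar F ℂ} (hψ : ∑ d ∈ D, ψ d + ∑ d ∈ D, ψ (-d) = -1) {c : ZMod p} (hc : c ≠ 0) :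
    2 * ∑ d ∈ D, ψ (algebraMap (ZMod p) F c * d) + 1 =
      ZMod.complexQuadraticChar p c * (2 * ∑ d ∈ D, ψ d + 1) := by
  rw [ZMod.complexQuadraticChar_apply]
  obtain h | h := quadraticChar_dichotomy hc
  · obtain ⟨b, rfl⟩ := (quadraticChar_one_iff_isSquare hc).1 h
    rw [h, map_mul, ← sq, sum_sq_mul_eq_sum hinv ψ (by simpa using hc)]
    simp
  · have hc' : -c ≠ 0 := neg_ne_zero.2 hc
    have h' : quadraticChar (ZMod p) (-c) = 1 := by
      rw [← neg_one_mul, map_mul, h, ZMod.quadraticChar_neg_one_of_mod_four hp]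
      norm_num
    obtain ⟨b, hb⟩ := (quadraticChar_one_iff_isSquare hc').1 h'
    have hb0 : b ≠ 0 := by
      rintro rfl
      simp_all
    obtain rfl : c = -(b * b) := by rw [← hb, neg_neg]
    have := sum_sq_mul_eq_sum hinv (fun x ↦ ψ (-x)) hb0
    rw [h, map_neg, map_mul, ← sq]
    simp_rw [neg_mul, this]
    push_cast
    linear_combination 2 * hψ

/-- The value `2ψ(D) + 1` is a rational multiple of a root of `-p`. -/
theorem exists_rat_two_mul_sum_add_one (hp : p % 4 = 3) {D : Finset F}
    (hinv : ∀ c : ZMod p, c ≠ 0 → ∀ d ∈ D, (algebraMap (ZMod p) F c) ^ 2 * d ∈ D)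
    {ψ : AddChar F ℂ} (hψ : ∑ d ∈ D, ψ d + ∑ d ∈ D, ψ (-d) = -1) {G : ℂ} (hG : G ^ 2 = -p) :
    ∃ r : ℚ, 2 * ∑ d ∈ D, ψ d + 1 = r * G := by
  have hgauss (d : F) : ∃ n : ℤ,
      ∑ c, ZMod.complexQuadraticChar p c * ψ (algebraMap (ZMod p) F c * d) = n * G :=
    ZMod.exists_gaussSum_eq_int_mul hp hG
      ((ψ.compAddMonoidHom (AddMonoidHom.mulRight d)).compAddMonoidHom
        (algebraMap (ZMod p) F).toAddMonoidHom)
  choose n hn using hgauss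
  have hp1 : (p : ℂ) - 1 ≠ 0 :=
    sub_ne_zero.2 (mod_cast (Fact.out : p.Prime).ne_one)
  have hsum : ((p : ℂ) - 1) * (2 * ∑ d ∈ D, ψ d + 1) = 2 * ∑ d ∈ D, n d * G := by
    have h₁ : ∑ c, ZMod.complexQuadraticChar p c *
          (2 * ∑ d ∈ D, ψ (algebraMap (ZMod p) F c * d) + 1) =
        ∑ c ∈ univ.erase (0 : ZMod p), (2 * ∑ d ∈ D, ψ d + 1) := by
      rw [← add_sum_erase _ _ (mem_univ (0 : ZMod p)), MulChar.map_zero, zero_mul, zero_add]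
      refine sum_congr rfl fun c hc ↦ ?_
      have hc := ne_of_mem_erase hc
      rw [two_mul_sum_mul_add_one hp hinv hψ hc, ← mul_assoc,
        ZMod.complexQuadraticChar_apply, ← sq, ← Int.cast_pow, quadraticChar_sq_one hc,
        Int.cast_one, one_mul]
    rw [sum_const, card_erase_of_mem (mem_univ _), card_univ, ZMod.card, nsmul_eq_mul,
      Nat.cast_pred (Fact.out : p.Prime).pos] at h₁
    rw [← h₁]
    simp_rw [mul_add, sum_add_distrib, mul_one,
      MulChar.sum_eq_zero_of_ne_one (ZMod.complexQuadraticChar_ne_one hp), add_zero, ← hn,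
      mul_sum]
    rw [sum_comm]
    exact sum_congr rfl fun _ _ ↦ sum_congr rfl fun _ _ ↦ by ring
  refine ⟨2 * (∑ d ∈ D, n d : ℤ) / (p - 1), ?_⟩
  rw [← sum_mul] at hsum
  push_cast
  field_simp
  linear_combination hsum

end

theorem eq_one_of_sum_le_card {ι : Type*} {s : Finset ι} {f : ι → ℤ} (hf : ∀ i ∈ s, 1 ≤ f i)
    (hs : ∑ i ∈ s, f i ≤ #s) : ∀ i ∈ s, f i = 1 := by
  have h : ∑ i ∈ s, (1 : ℤ) = ∑ i ∈ s, f i :=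
    le_antisymm (sum_le_sum hf) (by simpa using hs)
  exact fun i hi ↦ ((sum_eq_sum_iff_of_le hf).1 h i hi).symm


/-- If `D` is a skew-symmetric `(p^h-1)/2`-subset of `F_{p^h}` (`p ≡ 3 (mod 4)`, `h` odd)
invariant under multiplication by squares of `F_p^*`, and `2ψ(D) + 1` is divisible by
`p^{(h-1)/2}` as an algebraic integer for every nontrivial additive character `ψ`, then
`D` is a skew Hadamard difference set. -/
theorem stmt_15 (p : ℕ) [Fact p.Prime] (hp : p % 4 = 3) (h : ℕ) (hh : Odd h)
    (F : Type*) [Field F] [Fintype F] [Algebra (ZMod p) F] [DecidableEq F]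
    (hcardF : Fintype.card F = p ^ h)
    (D : Finset F) (h0 : (0 : F) ∉ D) (hcard : D.card = (p ^ h - 1) / 2)
    (hskew : ∀ x ∈ D, -x ∉ D)
    (hinv : ∀ c : ZMod p, c ≠ 0 → ∀ d ∈ D, (algebraMap (ZMod p) F c) ^ 2 * d ∈ D)
    (hdiv : ∀ ψ : AddChar F ℂ, ψ ≠ 1 →
      ∃ α : ℂ, IsIntegral ℤ α ∧
        2 * (∑ d ∈ D, ψ d) + 1 = (p : ℂ) ^ ((h - 1) / 2) * α) :
    (∀ x : F, x ≠ 0 → x ∈ D ∨ -x ∈ D) ∧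
    (∀ g : F, g ≠ 0 →
      ((D ×ˢ D).filter (fun z => z.1 - z.2 = g)).card = (p ^ h - 3) / 4) := by
  obtain ⟨m, rfl⟩ := hh
  set q := p ^ (2 * m + 1) with hq
  have hq4 : q % 4 = 3 := by
    rw [hq, pow_succ, pow_mul, Nat.mul_mod, Nat.pow_mod, Nat.pow_mod p, hp]
    simp
  have htot : ∀ x : F, x ≠ 0 → x ∈ D ∨ -x ∈ D := fun x hx ↦
    mem_or_neg_mem_of_card h0 (by rw [hcardF, hcard]; lia) hskew hx
  refine ⟨htot, ?_⟩
  have hcard' : (#D : ℂ) = (q - 1) / 2 := by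
    have : 2 * #D + 1 = q := by lia
    rw [← this]
    push_cast
    ring
  have hq0 : (q : ℂ) ≠ 0 := by
    have : q ≠ 0 := by lia
    exact_mod_cast this
  obtain ⟨G, hG⟩ := IsAlgClosed.exists_pow_nat_eq (-(p : ℂ)) two_pos
  have key (ψ : AddChar F ℂ) : ∃ t : ℤ, ψ ≠ 1 →
      1 ≤ t ^ 2 ∧ (∑ d ∈ D, ψ d) * (∑ d ∈ D, ψ (-d)) = (1 + q * t ^ 2) / 4 := by
    by_cases hψ : ψ = 1
    · exact ⟨0, fun h ↦ absurd hψ h⟩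
    have hneg := sum_add_sum_neg_eq_neg_one h0 hskew htot hψ
    obtain ⟨α, hα, hX⟩ := hdiv ψ hψ
    rw [Nat.add_sub_cancel, Nat.mul_div_cancel_left _ two_pos] at hX
    obtain ⟨r, hr⟩ := exists_rat_two_mul_sum_add_one hp hinv hneg hG
    have hpm : (p : ℂ) ^ m ≠ 0 := pow_ne_zero _ (mod_cast (Fact.out : p.Prime).ne_zero)
    obtain ⟨t, ht⟩ := exists_int_sq_eq_neg_prime_mul_sq (s := r / p ^ m) Fact.out hα hG <| by
      push_cast
      field_simp
      rw [← hr, hX]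
      ring
    have hX2 : (2 * ∑ d ∈ D, ψ d + 1) ^ 2 = -(q * t ^ 2) := by
      rw [hX, mul_pow, ht, hq]
      push_cast
      ring
    refine ⟨t, fun _ ↦ ⟨?_, ?_⟩⟩
    · have hne := two_mul_add_one_ne_zero_of_isIntegral
        (IsIntegral.sum (s := D) ψ fun d _ ↦ ψ.isIntegral_apply d)
      have : t ≠ 0 := by
        rintro rfl
        exact hne (pow_eq_zero_iff two_ne_zero |>.1 (by simpa using hX2))
      exact Int.add_one_le_iff.2 (sq_pos_iff.2 this)
    · linear_combination (∑ d ∈ D, ψ d) * hneg - hX2 / 4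
  choose t ht using key
  have hcardψ : #(univ.erase (1 : AddChar F ℂ)) = q - 1 := by
    rw [card_erase_of_mem (mem_univ _), card_univ, AddChar.card_eq, hcardF]
  have hcardψ' : (#(univ.erase (1 : AddChar F ℂ)) : ℂ) = q - 1 := by
    rw [hcardψ, Nat.cast_pred (by lia)]
  have hfourier (g : F) : (#D : ℂ) ^ 2 +
      ∑ ψ ∈ univ.erase (1 : AddChar F ℂ), (1 + q * (t ψ : ℂ) ^ 2) / 4 * ψ (-g) =
        q * #{z ∈ D ×ˢ D | z.1 - z.2 = g} := by
    rw [← hcardF, ← AddChar.sum_mul_sum_neg_mul_eq_card,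
      ← add_sum_erase _ _ (mem_univ (1 : AddChar F ℂ))]
    congr 1
    · simp [sq]
    · refine sum_congr rfl fun ψ hψ ↦ ?_
      rw [(ht ψ (ne_of_mem_erase hψ)).2, hcardF]
  have hdiag : #{z ∈ D ×ˢ D | z.1 - z.2 = 0} = #D := by
    rw [← diag_card D]
    congr 1
    ext ⟨a, b⟩
    simp only [mem_filter, mem_product, mem_diag, sub_eq_zero]
    exact ⟨fun h ↦ ⟨h.1.1, h.2⟩, fun h ↦ ⟨⟨h.1, h.2 ▸ h.1⟩, h.2⟩⟩
  have hsum : ∑ ψ ∈ univ.erase (1 : AddChar F ℂ), t ψ ^ 2 = #(univ.erase (1 : AddChar F ℂ)) := by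
    have h := hfourier 0
    simp only [neg_zero, AddChar.map_zero_eq_one, mul_one, hdiag] at h
    rw [← sum_div, sum_add_distrib, ← mul_sum, sum_const, nsmul_one, hcardψ', hcard'] at h
    have h' : (∑ ψ ∈ univ.erase (1 : AddChar F ℂ), (t ψ : ℂ) ^ 2) =
        #(univ.erase (1 : AddChar F ℂ)) := by
      rw [hcardψ']
      refine mul_left_cancel₀ hq0 ?_
      linear_combination 4 * h
    exact_mod_cast h'
  have hone := eq_one_of_sum_le_card (fun ψ hψ ↦ (ht ψ (ne_of_mem_erase hψ)).1) hsum.le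
  intro g hg
  have hψg : ∑ ψ ∈ univ.erase (1 : AddChar F ℂ), ψ (-g) = -1 := by
    have h := AddChar.sum_apply_eq_ite (-g)
    rw [if_neg (neg_ne_zero.2 hg), ← add_sum_erase _ _ (mem_univ (1 : AddChar F ℂ)),
      AddChar.one_apply] at h
    linear_combination h
  have h := hfourier g
  rw [sum_congr rfl (g := fun ψ ↦ (1 + q : ℂ) / 4 * ψ (-g)) fun ψ hψ ↦ by
      rw [← Int.cast_pow, hone ψ hψ, Int.cast_one, mul_one], ← mul_sum, hψg, hcard'] at h
  have hN : 4 * #{z ∈ D ×ˢ D | z.1 - z.2 = g} + 3 = q := by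
    have : (4 * #{z ∈ D ×ˢ D | z.1 - z.2 = g} + 3 : ℂ) = q := by
      refine mul_left_cancel₀ hq0 ?_
      linear_combination -4 * h
    exact_mod_cast this
  lia
end

section
/- Let f be an odd positive integer, p a prime, and N = 2·m₁·m₂···m_r with m_i = p_i^{u_i} powers of distinct odd primes, all coprime to p, such that the order of p modulo N equals f. If Σ_{i=0}^{f-1}[t p^i]_N = fN/2 for all t coprime to N, then m₁m₂···m_r divides 2^{4f} - 1. -/
open Complex Filter Topology MeasureTheory Set Asymptotics in
theorem mellin_geometric_one {z : ℂ} (hz : ‖z‖ = 1) (hz1 : z ≠ 1) :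
    ContinuousAt (mellin fun t : ℝ ↦ z * Real.exp (-t) / (1 - z * Real.exp (-t))) 1 ∧
    mellin (fun t : ℝ ↦ z * Real.exp (-t) / (1 - z * Real.exp (-t))) 1 = -log (1 - z) := by
  set F : ℝ → ℂ := fun t ↦ z * Real.exp (-t) / (1 - z * Real.exp (-t)) with hF
  have hre_lt {t : ℝ} (ht : 0 ≤ t) : (z * Real.exp (-t)).re < 1 := by
    have hz_re : z.re < 1 := by
      refine lt_of_le_of_ne (hz ▸ re_le_norm z) fun h ↦ hz1 ?_
      have := Complex.sq_norm z
      rw [hz, normSq_apply, h] at this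
      exact Complex.ext h (by simpa using (by linarith : z.im * z.im = 0))
    have he := Real.exp_pos (-t)
    have he1 : Real.exp (-t) ≤ 1 := Real.exp_le_one_iff.mpr (by linarith)
    rw [re_mul_ofReal]
    nlinarith
  have hslit {t : ℝ} (ht : 0 ≤ t) : 1 - z * Real.exp (-t) ∈ slitPlane :=
    Or.inl (by rw [sub_re, one_re]; linarith [hre_lt ht])
  have hne {t : ℝ} (ht : 0 ≤ t) : 1 - z * Real.exp (-t) ≠ 0 := slitPlane_ne_zero (hslit ht)
  have hcont : ContinuousOn F (Ici 0) :=
    ContinuousOn.div (by fun_prop) (by fun_prop) fun t ht ↦ hne ht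
  have hloc : LocallyIntegrableOn F (Ioi 0) :=
    (hcont.mono Ioi_subset_Ici_self).locallyIntegrableOn measurableSet_Ioi
  have hlim : Tendsto (fun t : ℝ ↦ 1 - z * Real.exp (-t)) atTop (𝓝 1) := by
    have h0 : Tendsto (fun t : ℝ ↦ (Real.exp (-t) : ℂ)) atTop (𝓝 0) := by
      exact_mod_cast (continuous_ofReal.tendsto 0).comp
        (Real.tendsto_exp_atBot.comp tendsto_neg_atTop_atBot)
    simpa using (h0.const_mul z).const_sub 1
  have htop : F =O[atTop] fun t ↦ Real.exp (-1 * t) := by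
    have h1 : (fun t : ℝ ↦ (1 - z * Real.exp (-t))⁻¹) =O[atTop] fun _ ↦ (1 : ℝ) :=
      (hlim.inv₀ one_ne_zero).isBigO_one ℝ
    have h2 : (fun t : ℝ ↦ z * Real.exp (-t)) =O[atTop] fun t ↦ Real.exp (-1 * t) :=
      IsBigO.of_bound 1 (Eventually.of_forall fun t ↦ by
        rw [norm_mul, hz, norm_real]; simp)
    simpa [hF, div_eq_mul_inv] using h2.mul h1
  have hbot : F =O[𝓝[>] 0] fun t ↦ t ^ (-(0 : ℝ)) := by
    have : Tendsto F (𝓝[>] 0) (𝓝 (F 0)) :=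
      (hcont 0 self_mem_Ici).mono_left (nhdsWithin_mono _ Ioi_subset_Ici_self)
    simpa using this.isBigO_one ℝ
  refine ⟨(mellin_differentiableAt_of_isBigO_rpow_exp one_pos hloc htop hbot
    (by simp)).continuousAt, ?_⟩
  have hint : IntegrableOn F (Ioi 0) := by
    simpa [MellinConvergent] using
      mellinConvergent_of_isBigO_rpow_exp (s := 1) one_pos hloc htop hbot (by simp)
  have hderiv : ∀ t ∈ Ici (0 : ℝ), HasDerivAt (fun t : ℝ ↦ log (1 - z * Real.exp (-t))) (F t) t := by
    intro t ht
    have h1 : HasDerivAt (fun t : ℝ ↦ (Real.exp (-t) : ℂ)) ((-Real.exp (-t) : ℝ) : ℂ) t := by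
      refine HasDerivAt.ofReal_comp ?_
      simpa using (hasDerivAt_neg t).exp
    convert ((h1.const_mul z).const_sub 1).clog_real (hslit ht) using 1
    simp [hF]
  have := integral_Ioi_of_hasDerivAt_of_tendsto' hderiv hint
    (hlim.clog (by simp))
  simpa [mellin] using this

open Complex Filter Topology in
theorem expZeta_one {a : ℝ} (ha : (a : UnitAddCircle) ≠ 0) :
    HurwitzZeta.expZeta a 1 = -log (1 - exp (2 * Real.pi * I * a)) := by
  set z := exp (2 * Real.pi * I * a) with hzdef
  have hz : ‖z‖ = 1 := by
    rw [hzdef, show 2 * Real.pi * I * a = ((2 * Real.pi * a : ℝ) : ℂ) * I by push_cast; ring]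
    exact norm_exp_ofReal_mul_I _
  have hz1 : z ≠ 1 := by
    intro h
    obtain ⟨n, hn⟩ := exp_eq_one_iff.mp h
    apply ha
    have : (a : ℂ) = n := by
      have : (2 * Real.pi * I : ℂ) ≠ 0 := two_pi_I_ne_zero
      apply mul_left_cancel₀ this
      rw [hn]; ring
    have : a = n := by exact_mod_cast this
    rw [this]
    exact (AddCircle.coe_eq_zero_iff 1).mpr ⟨n, by simp⟩
  obtain ⟨hc, hval⟩ := mellin_geometric_one hz hz1
  rw [← hval]
  have hL : Tendsto (fun x : ℝ ↦ Gamma x * HurwitzZeta.expZeta a x) (𝓝[>] 1)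
      (𝓝 (HurwitzZeta.expZeta a 1)) := by
    have h1 : ContinuousAt (fun s : ℂ ↦ Gamma s * HurwitzZeta.expZeta a s) 1 :=
      (differentiableAt_Gamma_one.continuousAt).mul
        (HurwitzZeta.differentiable_expZeta_of_ne_zero ha 1).continuousAt
    have h2 : Tendsto (fun x : ℝ ↦ (x : ℂ)) (𝓝[>] 1) (𝓝 1) :=
      tendsto_nhdsWithin_of_tendsto_nhds (by exact_mod_cast continuous_ofReal.tendsto 1)
    simpa [Function.comp_def] using h1.tendsto.comp h2
  have hR : Tendsto (fun x : ℝ ↦ mellin (fun t : ℝ ↦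
      z * Real.exp (-t) / (1 - z * Real.exp (-t))) x) (𝓝[>] 1)
      (𝓝 (mellin (fun t : ℝ ↦ z * Real.exp (-t) / (1 - z * Real.exp (-t))) 1)) :=
    hc.tendsto.comp
      (tendsto_nhdsWithin_of_tendsto_nhds (by exact_mod_cast continuous_ofReal.tendsto 1))
  refine tendsto_nhds_unique hL (hR.congr' ?_)
  filter_upwards [self_mem_nhdsWithin] with x hx
  have hx : 1 < x := hx
  have hs := HurwitzZeta.hasSum_expZeta_of_one_lt_re a (s := x) (by simpa using hx)
  rw [← hasSum_nat_add_iff' 1] at hs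
  have hpow (n : ℕ) : exp (2 * Real.pi * I * a * n) = z ^ n := by
    rw [hzdef, ← exp_nat_mul]; ring_nf
  have hx0 : (x : ℂ) ≠ 0 := by exact_mod_cast (by linarith : x ≠ 0)
  have hs' := hs.mul_left (Gamma x)
  refine HasSum.unique ?_ (by simpa [hx0] using hs')
  convert hasSum_mellin (a := fun n : ℕ ↦ z ^ (n + 1)) (p := fun n ↦ n + 1) (s := x)
    (F := fun t : ℝ ↦ z * Real.exp (-t) / (1 - z * Real.exp (-t)))
    (fun n ↦ .inr (by positivity)) (by simpa using by linarith) ?_ ?_ using 2 with n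
  · have := hpow (n + 1)
    push_cast at this ⊢
    rw [this]; ring
  · intro t ht
    have ht : 0 < t := ht
    have hw : ‖z * Real.exp (-t)‖ < 1 := by
      rw [norm_mul, hz, norm_real, one_mul, Real.norm_eq_abs, Real.abs_exp]
      exact Real.exp_lt_one_iff.mpr (by linarith)
    refine ((hasSum_geometric_of_norm_lt_one hw).mul_left (z * Real.exp (-t))).congr_fun
      fun n ↦ ?_
    rw [← pow_succ', mul_pow, ← ofReal_pow, ← Real.exp_nat_mul]
    push_cast
    ring_nf
  · simp only [norm_pow, hz, one_pow, ofReal_re]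
    exact_mod_cast (summable_nat_add_iff 1).mpr (Real.summable_one_div_nat_rpow.mpr hx)

open Complex HurwitzZeta in
theorem hurwitzZeta_zero_eq {a : ℝ} (ha0 : 0 < a) (ha1 : a < 1) :
    hurwitzZeta a 0 = 1 / 2 - a := by
  have ha : (a : UnitAddCircle) ≠ 0 := by
    rw [Ne, AddCircle.coe_eq_zero_iff]
    rintro ⟨n, hn⟩
    rw [zsmul_eq_mul, mul_one] at hn
    have h1 : (0 : ℤ) < n := by exact_mod_cast hn ▸ ha0
    have h2 : n < (1 : ℤ) := by exact_mod_cast hn ▸ ha1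
    omega
  have hpi := Real.pi_pos
  have hlog : ∀ {b : ℝ}, 0 < b → b < 1 → (log (1 - exp (2 * Real.pi * I * b))) =
      Real.log (2 * Real.sin (Real.pi * b)) + (Real.pi * b - Real.pi / 2 : ℝ) * I := by
    intro b hb0 hb1
    have hsin : 0 < 2 * Real.sin (Real.pi * b) :=
      mul_pos two_pos (Real.sin_pos_of_pos_of_lt_pi (by positivity) (by nlinarith))
    rw [show 1 - exp (2 * Real.pi * I * b) =
      exp (Real.log (2 * Real.sin (Real.pi * b)) + (Real.pi * b - Real.pi / 2 : ℝ) * I) from ?_]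
    · refine log_exp ?_ ?_
      · simp
        nlinarith
      · simp
        nlinarith
    · rw [exp_add, ← ofReal_exp, Real.exp_log hsin]
      push_cast
      rw [sub_mul, exp_sub, Complex.sin, show (Real.pi : ℂ) / 2 * I = Real.pi / 2 * I by rfl,
        exp_pi_div_two_mul_I, show 2 * Real.pi * I * b = Real.pi * b * I + Real.pi * b * I by ring,
        exp_add, neg_mul, exp_neg]
      have := exp_ne_zero (Real.pi * b * I)
      field_simp
  have h := hurwitzZeta_one_sub (a : UnitAddCircle) (s := 1)
    (fun n hn ↦ by
      have := congrArg re hn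
      simp at this
      have : (0 : ℝ) ≤ n := n.cast_nonneg
      linarith) (.inl ha)
  have hneg : (-(a : UnitAddCircle)) = ((1 - a : ℝ) : UnitAddCircle) := by
    rw [AddCircle.coe_sub, AddCircle.coe_period, zero_sub]
  have ha' : ((1 - a : ℝ) : UnitAddCircle) ≠ 0 := hneg ▸ neg_ne_zero.mpr ha
  rw [sub_self] at h
  rw [h, hneg, expZeta_one ha, expZeta_one ha', hlog ha0 ha1, hlog (by linarith) (by linarith),
    show Real.pi * (1 - a) = Real.pi - Real.pi * a by ring, Real.sin_pi_sub, mul_one, mul_one,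
    show -(Real.pi : ℂ) * I / 2 = -(Real.pi / 2 * I) by ring,
    show (Real.pi : ℂ) * I / 2 = Real.pi / 2 * I by ring, exp_neg, exp_pi_div_two_mul_I, Gamma_one,
    cpow_neg_one, inv_I]
  have : (Real.pi : ℂ) ≠ 0 := by exact_mod_cast hpi.ne'
  push_cast
  field_simp
  linear_combination (Real.pi * (4 * a - 2) : ℂ) * I_sq

namespace DirichletCharacter

theorem LFunction_zero_eq_sum {N : ℕ} [NeZero N] (hN : N ≠ 1) (χ : DirichletCharacter ℂ N) :
    χ.LFunction 0 = ∑ j : ZMod N, χ j * (1 / 2 - j.val / N) := by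
  have hN0 : (0 : ℝ) < N := by exact_mod_cast NeZero.pos N
  rw [LFunction, ZMod.LFunction, neg_zero, Complex.cpow_zero, one_mul]
  refine Finset.sum_congr rfl fun j _ ↦ ?_
  rcases eq_or_ne j 0 with rfl | hj
  · rw [χ.map_zero' hN, zero_mul, zero_mul]
  · rw [ZMod.toAddCircle_apply, hurwitzZeta_zero_eq]
    · push_cast
      rfl
    · have : 0 < j.val := Nat.pos_of_ne_zero fun h ↦ hj ((ZMod.val_eq_zero j).mp h)
      positivity
    · rw [div_lt_one hN0]
      exact_mod_cast j.val_lt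

theorem Odd.ne_one {N : ℕ} {χ : DirichletCharacter ℂ N} (hχ : χ.Odd) : χ ≠ 1 := by
  rintro rfl
  have h : (1 : DirichletCharacter ℂ N) (-1) = -1 := hχ
  rw [MulChar.one_apply isUnit_one.neg] at h
  norm_num at h

theorem IsPrimitive.LFunction_zero_ne_zero {N : ℕ} [NeZero N] {χ : DirichletCharacter ℂ N}
    (hχ : χ.IsPrimitive) (hodd : χ.Odd) : χ.LFunction 0 ≠ 0 := by
  have hN : N ≠ 1 := fun h ↦ hodd.ne_one (level_one' χ h)
  have hprim : χ⁻¹.IsPrimitive := by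
    rw [isPrimitive_def, conductor_inv]
    exact hχ
  have h1 := LFunction_apply_one_ne_zero (χ := χ⁻¹) (inv_ne_one.mpr hodd.ne_one)
  rw [LFunction_eq_completed_div_gammaFactor _ _ (.inr hN)] at h1
  have h2 := hprim.completedLFunction_one_sub 0
  rw [sub_zero, inv_inv] at h2
  rw [LFunction_eq_completed_div_gammaFactor _ _ (.inr hN), hodd.gammaFactor_def, zero_add,
    Complex.Gammaℝ_one, div_one]
  intro h0
  rw [h2, h0, mul_zero, zero_div] at h1
  exact h1 rfl

theorem Odd.exists_prime_primitiveCharacter_eq_one {N : ℕ} [NeZero N] {χ : DirichletCharacter ℂ N}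
    (hodd : χ.Odd) (h0 : χ.LFunction 0 = 0) :
    ∃ q : ℕ, q.Prime ∧ q ∣ N ∧ χ.primitiveCharacter q = 1 := by
  have : NeZero χ.conductor := ⟨χ.conductor_ne_zero⟩
  have hχ := χ.changeLevel_primitiveCharacter
  have hodd' : χ.primitiveCharacter.Odd := by
    have := changeLevel_eq_cast_of_dvd' χ.primitiveCharacter χ.conductor_dvd_level (a := -1)
      isCoprime_one_left.neg_left
    rw [hχ] at this
    push_cast at this
    exact this.symm.trans hodd
  rw [← hχ, LFunction_changeLevel _ _ (.inl hodd'.ne_one)] at h0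
  have h := (mul_eq_zero.mp h0).resolve_left
    (χ.primitiveCharacter_isPrimitive.LFunction_zero_ne_zero hodd')
  obtain ⟨q, hq, hq0⟩ := Finset.prod_eq_zero_iff.mp h
  rw [neg_zero, Complex.cpow_zero, mul_one, sub_eq_zero] at hq0
  exact ⟨q, Nat.prime_of_mem_primeFactors hq, Nat.dvd_of_mem_primeFactors hq, hq0.symm⟩

theorem LFunction_zero_eq_zero_of_pure {N f p : ℕ} [NeZero N] (hN : N ≠ 1) (hf : f ≠ 0)
    (hpu : IsUnit (p : ZMod N))
    (hpure : ∀ t : ℤ, Int.gcd t N = 1 →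
      2 * ∑ i ∈ Finset.range f, (t * (p : ℤ) ^ i) % N = (f : ℤ) * N)
    {χ : DirichletCharacter ℂ N} (hχ : χ p = 1) : χ.LFunction 0 = 0 := by
  have hN0 : (N : ℂ) ≠ 0 := by exact_mod_cast NeZero.ne N
  have hshift (i : ℕ) : χ.LFunction 0 =
      ∑ j : ZMod N, χ j * (1 / 2 - (j * (p : ZMod N) ^ i).val / N) := by
    rw [LFunction_zero_eq_sum hN,
      ← Equiv.sum_comp (hpu.pow i).unit.mulRight (fun j ↦ χ j * (1 / 2 - (j.val : ℂ) / N))]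
    refine Finset.sum_congr rfl fun j _ ↦ ?_
    simp [hχ]
  have hsum : (f : ℂ) * χ.LFunction 0 = 0 := by
    calc (f : ℂ) * χ.LFunction 0 = ∑ i ∈ Finset.range f, χ.LFunction 0 := by simp
      _ = ∑ i ∈ Finset.range f, ∑ j : ZMod N, χ j * (1 / 2 - (j * (p : ZMod N) ^ i).val / N) :=
        Finset.sum_congr rfl fun i _ ↦ hshift i
      _ = ∑ j : ZMod N, χ j * ∑ i ∈ Finset.range f,
          (1 / 2 - ((j * (p : ZMod N) ^ i).val : ℂ) / N) := by
        rw [Finset.sum_comm]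
        simp_rw [Finset.mul_sum]
      _ = 0 := Finset.sum_eq_zero fun j _ ↦ ?_
    by_cases hj : IsUnit j
    · have hgcd : Int.gcd (j.val : ℤ) N = 1 := by
        rw [Int.gcd_natCast_natCast]
        exact (ZMod.isUnit_iff_coprime j.val N).mp (by simpa using hj)
      have h := hpure j.val hgcd
      have hterm (i : ℕ) :
          ((j.val : ℤ) * (p : ℤ) ^ i) % N = ((j * (p : ZMod N) ^ i).val : ℤ) := by
        rw [← ZMod.val_intCast]
        push_cast
        rw [ZMod.natCast_zmod_val]
      simp_rw [hterm] at h
      have h' : 2 * ∑ i ∈ Finset.range f, ((j * (p : ZMod N) ^ i).val : ℂ) = f * N := by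
        exact_mod_cast h
      have h'' : ∑ i ∈ Finset.range f, ((j * (p : ZMod N) ^ i).val : ℂ) = f * N / 2 := by
        linear_combination h' / 2
      rw [Finset.sum_sub_distrib, Finset.sum_const, Finset.card_range, nsmul_eq_mul,
        ← Finset.sum_div, h'']
      field_simp
      simp
    · rw [χ.map_nonunit hj, zero_mul]
  exact (mul_eq_zero.mp hsum).resolve_left (by exact_mod_cast hf)

end DirichletCharacter

theorem MulChar.prod_apply_of_isUnit {R R' ι : Type*} [CommMonoid R] [CommMonoidWithZero R']
    (s : Finset ι) (χ : ι → MulChar R R') {a : R} (ha : IsUnit a) :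
    (∏ i ∈ s, χ i) a = ∏ i ∈ s, χ i a := by
  classical
  induction s using Finset.induction_on with
  | empty => simpa using MulChar.one_apply ha
  | insert i s hi ih => rw [Finset.prod_insert hi, Finset.prod_insert hi, MulChar.mul_apply, ih]

section LocalComponents

open DirichletCharacter

variable {ι : Type*} [Fintype ι] {q u : ι → ℕ}

theorem dvd_two_mul_prod_pow (i : ι) : q i ^ u i ∣ 2 * ∏ j, q j ^ u j :=
  (Finset.dvd_prod_of_mem _ (Finset.mem_univ i)).mul_left 2

/-- The Dirichlet character modulo `2 * ∏ i, q i ^ u i` with components `χ i`. -/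
noncomputable def charOfComponents (χ : ∀ i, DirichletCharacter ℂ (q i ^ u i)) :
    DirichletCharacter ℂ (2 * ∏ i, q i ^ u i) :=
  ∏ i, changeLevel (dvd_two_mul_prod_pow i) (χ i)

theorem charOfComponents_apply (χ : ∀ i, DirichletCharacter ℂ (q i ^ u i)) {t : ℤ}
    (ht : IsCoprime t ((2 * ∏ i, q i ^ u i : ℕ) : ℤ)) :
    charOfComponents χ t = ∏ i, χ i t := by
  rw [charOfComponents, MulChar.prod_apply_of_isUnit]
  · exact Finset.prod_congr rfl fun i _ ↦ changeLevel_eq_cast_of_dvd' _ _ ht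
  · exact (ZMod.coe_int_isUnit_iff_isCoprime _ _).mpr ht.symm

theorem dvd_conductor_charOfComponents (hq : ∀ i, (q i).Prime) (hq2 : ∀ i, q i ≠ 2)
    (hinj : Function.Injective q) {χ : ∀ i, DirichletCharacter ℂ (q i ^ u i)} {i : ι}
    (hi : χ i ≠ 1) : q i ∣ (charOfComponents χ).conductor := by
  classical
  by_contra hdvd
  set X := charOfComponents χ
  set d := X.conductor
  have : NeZero (q i ^ u i) := ⟨pow_ne_zero _ (hq i).ne_zero⟩
  obtain ⟨y, hy⟩ := MulChar.ne_one_iff.mp hi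
  set m' := 2 * ∏ j ∈ Finset.univ.erase i, q j ^ u j
  have hN : 2 * ∏ j, q j ^ u j = q i ^ u i * m' := by
    rw [← Finset.mul_prod_erase _ _ (Finset.mem_univ i)]
    ring
  have hcop : Nat.Coprime (q i ^ u i) m' := by
    refine Nat.Coprime.mul_right ?_ (Nat.Coprime.prod_right fun j hj ↦ ?_)
    · exact Nat.Coprime.pow_left _ ((Nat.coprime_primes (hq i) Nat.prime_two).mpr (hq2 i))
    · exact Nat.Coprime.pow _ _ ((Nat.coprime_primes (hq i) (hq j)).mpr
        (hinj.ne (Finset.ne_of_mem_erase hj).symm))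
  obtain ⟨t, ht1, ht2⟩ := Nat.chineseRemainder hcop (y : ZMod (q i ^ u i)).val 1
  have hdm : d ∣ m' := by
    have h : d ∣ q i ^ u i * m' := hN ▸ X.conductor_dvd_level
    exact (Nat.Coprime.pow_right _ ((hq i).coprime_iff_not_dvd.mpr hdvd).symm).dvd_of_dvd_mul_left h
  have hti : (t : ZMod (q i ^ u i)) = y := by
    rw [(ZMod.natCast_eq_natCast_iff _ _ _).mpr ht1, ZMod.natCast_zmod_val]
  have hone {n : ℕ} (hn : n ∣ m') : (t : ZMod n) = 1 := by
    simpa using (ZMod.natCast_eq_natCast_iff _ _ _).mpr (ht2.of_dvd hn)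
  have htN : IsCoprime (t : ℤ) ((2 * ∏ j, q j ^ u j : ℕ) : ℤ) := by
    rw [Nat.isCoprime_iff_coprime, hN]
    refine Nat.Coprime.mul_right ?_ ?_
    · rw [← ZMod.isUnit_iff_coprime, hti]
      exact y.isUnit
    · rw [← ZMod.isUnit_iff_coprime, hone dvd_rfl]
      exact isUnit_one
  have h1 : X (t : ℤ) = 1 := by
    rw [← X.changeLevel_primitiveCharacter, changeLevel_eq_cast_of_dvd' _ _ htN, Int.cast_natCast,
      hone hdm, map_one]
  rw [charOfComponents_apply χ htN, ← Finset.mul_prod_erase _ _ (Finset.mem_univ i),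
    Finset.prod_eq_one, mul_one, Int.cast_natCast, hti] at h1
  · exact hy h1
  · intro j hj
    rw [Int.cast_natCast, hone ((Finset.dvd_prod_of_mem _ hj).mul_left 2), map_one]

theorem prod_apply_two_eq_one (hq : ∀ i, (q i).Prime) (hq2 : ∀ i, q i ≠ 2)
    (hinj : Function.Injective q) {p : ℕ} (hp : p.Coprime (2 * ∏ i, q i ^ u i))
    [NeZero (2 * ∏ i, q i ^ u i)]
    (hL : ∀ χ : DirichletCharacter ℂ (2 * ∏ i, q i ^ u i), χ p = 1 → χ.LFunction 0 = 0)
    {χ : ∀ i, DirichletCharacter ℂ (q i ^ u i)} (hne : ∀ i, χ i ≠ 1)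
    (hχp : ∏ i, χ i p = 1) (hodd : ∏ i, χ i (-1) = -1) : ∏ i, χ i 2 = 1 := by
  set X := charOfComponents χ
  have hXp : X p = 1 := by
    have := charOfComponents_apply χ (t := p) (Nat.isCoprime_iff_coprime.mpr hp)
    simpa [hχp] using this
  have hXodd : X.Odd := by
    have := charOfComponents_apply χ (t := -1) isCoprime_one_left.neg_left
    push_cast at this
    exact this.trans hodd
  obtain ⟨l, hl, hlN, hl1⟩ := hXodd.exists_prime_primitiveCharacter_eq_one (hL X hXp)
  have hunit : IsUnit (l : ZMod X.conductor) := by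
    by_contra h
    rw [MulChar.map_nonunit _ h] at hl1
    exact zero_ne_one hl1
  rw [ZMod.isUnit_iff_coprime] at hunit
  obtain rfl : l = 2 := by
    by_contra hl2
    rcases hl.dvd_mul.mp hlN with h | h
    · exact hl2 ((Nat.prime_dvd_prime_iff_eq hl Nat.prime_two).mp h)
    · obtain ⟨i, -, hi⟩ := (hl.prime.dvd_finsetProd_iff _).mp h
      obtain rfl := (Nat.prime_dvd_prime_iff_eq hl (hq i)).mp (hl.dvd_of_dvd_pow hi)
      exact hl.one_lt.ne' (Nat.eq_one_of_dvd_coprimes hunit dvd_rfl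
        (dvd_conductor_charOfComponents hq hq2 hinj (hne i)))
  have hM : Nat.Coprime 2 (∏ i, q i ^ u i) := Nat.Coprime.prod_right fun i _ ↦
    Nat.Coprime.pow_right _ ((Nat.coprime_primes Nat.prime_two (hq i)).mpr (hq2 i).symm)
  have hdM : X.conductor ∣ ∏ i, q i ^ u i := hunit.symm.dvd_of_dvd_mul_left X.conductor_dvd_level
  have ht : IsCoprime ((2 + ∏ i, q i ^ u i : ℕ) : ℤ) ((2 * ∏ i, q i ^ u i : ℕ) : ℤ) := by
    rw [Nat.isCoprime_iff_coprime]
    exact Nat.Coprime.mul_right (Nat.coprime_self_add_left.mpr hM.symm) (by simpa using hM)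
  have hcast {n : ℕ} (hn : n ∣ ∏ i, q i ^ u i) : (((2 + ∏ i, q i ^ u i : ℕ) : ℤ) : ZMod n) = (2 : ℕ) := by
    rw [Int.cast_natCast, Nat.cast_add, (ZMod.natCast_eq_zero_iff _ n).mpr hn, add_zero]
  have h1 : X ((2 + ∏ i, q i ^ u i : ℕ) : ℤ) = 1 := by
    rw [← X.changeLevel_primitiveCharacter, changeLevel_eq_cast_of_dvd' _ _ ht, hcast hdM, hl1]
  rw [charOfComponents_apply χ ht] at h1
  rw [← h1]
  refine Finset.prod_congr rfl fun i _ ↦ ?_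
  rw [hcast (Finset.dvd_prod_of_mem _ (Finset.mem_univ i)), Nat.cast_ofNat]

theorem apply_two_pow_four_eq_one (hq : ∀ i, (q i).Prime) (hq2 : ∀ i, q i ≠ 2)
    (hinj : Function.Injective q) {p : ℕ} (hp : p.Coprime (2 * ∏ i, q i ^ u i))
    [NeZero (2 * ∏ i, q i ^ u i)]
    (hL : ∀ χ : DirichletCharacter ℂ (2 * ∏ i, q i ^ u i), χ p = 1 → χ.LFunction 0 = 0)
    {ω : ∀ i, DirichletCharacter ℂ (q i ^ u i)} (hω : ∀ i, (ω i).Odd) (hωp : ∀ i, ω i p = 1)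
    {i : ι} {ψ : DirichletCharacter ℂ (q i ^ u i)} (hψ : ψ p = 1) : ψ 2 ^ 4 = 1 := by
  classical
  have hupd (α : DirichletCharacter ℂ (q i ^ u i)) (t : ℤ) :
      ∏ j, Function.update ω i α j t = α t * ∏ j ∈ Finset.univ.erase i, ω j t := by
    rw [← Finset.mul_prod_erase _ _ (Finset.mem_univ i), Function.update_self]
    congr 1
    exact Finset.prod_congr rfl fun j hj ↦ by
      rw [Function.update_of_ne (Finset.ne_of_mem_erase hj)]
  set c := ∏ j ∈ Finset.univ.erase i, ω j 2
  set s := ∏ j ∈ Finset.univ.erase i, ω j (-1) with hs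
  have key {α : DirichletCharacter ℂ (q i ^ u i)} (h1 : α ≠ 1) (hαp : α p = 1)
      (hodd : α (-1) * s = -1) : α 2 * c = 1 := by
    have := prod_apply_two_eq_one hq hq2 hinj hp hL (χ := Function.update ω i α) ?_ ?_ ?_
    · simpa using (hupd α 2).symm.trans (by simpa using this)
    · intro j
      rcases eq_or_ne j i with rfl | hj
      · simpa using h1
      · rw [Function.update_of_ne hj]
        exact (hω j).ne_one
    · simpa [hαp, hωp] using hupd α p
    · simpa [hodd, ← hs] using hupd α (-1)
  have hsq : ψ (-1) ^ 2 = 1 := by rw [← map_pow, neg_one_sq, map_one]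
  have hs' : s = 1 ∨ s = -1 := by
    rw [hs, Finset.prod_congr rfl fun j _ ↦ show ω j (-1) = -1 from hω j, Finset.prod_const]
    exact neg_one_pow_eq_or ℂ _
  have hωi : ω i (-1) = -1 := hω i
  rcases hs' with h | h
  · have h1 := key (hω i).ne_one (hωp i) (by rw [hωi, h, mul_one])
    have hodd : (ψ ^ 2 * ω i) (-1) = -1 := by
      rw [MulChar.mul_apply, MulChar.pow_apply' _ two_ne_zero, hsq, hωi, one_mul]
    have h2 := key (α := ψ ^ 2 * ω i) (Odd.ne_one hodd)
      (by rw [MulChar.mul_apply, MulChar.pow_apply' _ two_ne_zero, hψ, hωp]; norm_num)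
      (by rw [hodd, h, mul_one])
    rw [MulChar.mul_apply, MulChar.pow_apply' _ two_ne_zero, mul_assoc, h1, mul_one] at h2
    rw [show 4 = 2 * 2 from rfl, pow_mul, h2, one_pow]
  · by_cases h4 : ψ ^ 4 = 1
    · have h2u : IsUnit (2 : ZMod (q i ^ u i)) := by
        have := (ZMod.isUnit_iff_coprime 2 (q i ^ u i)).mpr
          (Nat.Coprime.pow_right _ ((Nat.coprime_primes Nat.prime_two (hq i)).mpr (hq2 i).symm))
        simpa using this
      rw [← MulChar.pow_apply' _ four_ne_zero, h4, MulChar.one_apply h2u]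
    · have h2 : ψ ^ 2 ≠ 1 := fun h2 ↦ h4 (by rw [show 4 = 2 * 2 from rfl, pow_mul, h2, one_pow])
      have e1 := key (α := ψ ^ 2) h2 (by rw [MulChar.pow_apply' _ two_ne_zero, hψ, one_pow])
        (by rw [MulChar.pow_apply' _ two_ne_zero, hsq, h, one_mul])
      have e2 := key (α := ψ ^ 4) h4 (by rw [MulChar.pow_apply' _ four_ne_zero, hψ, one_pow])
        (by rw [MulChar.pow_apply' _ four_ne_zero, show 4 = 2 * 2 from rfl, pow_mul, hsq, h]; simp)
      rw [MulChar.pow_apply' _ two_ne_zero] at e1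
      rw [MulChar.pow_apply' _ four_ne_zero] at e2
      linear_combination -(ψ 2 ^ 2 + 1) * (ψ 2 ^ 2 * e1 - e2)

end LocalComponents

theorem DirichletCharacter.exists_odd_apply_eq_one {n f p : ℕ} (hn : 2 < n) (hf : _root_.Odd f)
    (hp : (p : ZMod n) ^ f = 1) : ∃ χ : DirichletCharacter ℂ n, χ.Odd ∧ χ p = 1 := by
  have : NeZero n := ⟨by lia⟩
  have : Fact (2 < n) := ⟨hn⟩
  obtain ⟨χ, hχ⟩ := exists_apply_ne_one_of_hasEnoughRootsOfUnity ℂ (ZMod.neg_one_ne_one (n := n))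
  have hχ' : χ (-1) = -1 := χ.even_or_odd.resolve_left hχ
  refine ⟨χ ^ f, ?_, ?_⟩
  · rw [DirichletCharacter.Odd, MulChar.pow_apply' _ hf.pos.ne', hχ', hf.neg_one_pow]
  · rw [MulChar.pow_apply' _ hf.pos.ne', ← map_pow, hp, map_one]

/-- Aoki's bound: if `f` is odd, `N = 2·m₁⋯m_r` with `mᵢ` powers of distinct odd primes
coprime to `p`, the order of `p` mod `N` is `f`, and the Gauss sum `G_{p^f}(η_N)` is pure
(Stickelberger criterion), then `m₁⋯m_r` divides `2^{4f} - 1`. -/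
theorem stmt_18 (p : ℕ) (hp : p.Prime) (f : ℕ) (hfodd : Odd f)
    (r : ℕ) (q : Fin r → ℕ) (u : Fin r → ℕ)
    (hq : ∀ i, (q i).Prime ∧ q i ≠ 2 ∧ q i ≠ p) (hu : ∀ i, 1 ≤ u i)
    (hdist : Function.Injective q)
    (N : ℕ) (hN : N = 2 * ∏ i, q i ^ u i)
    (hf : f = orderOf ((p : ZMod N)))
    (hpure : ∀ t : ℤ, Int.gcd t N = 1 →
      2 * ∑ i ∈ Finset.range f, (t * (p : ℤ) ^ i) % N = (f : ℤ) * N) :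
    (∏ i, q i ^ u i) ∣ 2 ^ (4 * f) - 1 := by
  subst hN
  have hqp := fun i ↦ (hq i).1
  have hq2 := fun i ↦ (hq i).2.1
  have hne (i) : NeZero (q i ^ u i) := ⟨pow_ne_zero _ (hqp i).ne_zero⟩
  have : NeZero (2 * ∏ i, q i ^ u i) :=
    ⟨mul_ne_zero two_ne_zero (Finset.prod_ne_zero_iff.mpr fun i _ ↦ (hne i).ne)⟩
  have hpf : (p : ZMod (2 * ∏ i, q i ^ u i)) ^ f = 1 := hf ▸ pow_orderOf_eq_one _
  have hpu : IsUnit (p : ZMod (2 * ∏ i, q i ^ u i)) := IsUnit.of_pow_eq_one hpf hfodd.pos.ne'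
  have hpf' (i) : (p : ZMod (q i ^ u i)) ^ f = 1 := by
    rw [← map_natCast (ZMod.castHom (dvd_two_mul_prod_pow i) (ZMod (q i ^ u i))), ← map_pow, hpf,
      map_one]
  have hlt (i) : 2 < q i ^ u i :=
    ((hqp i).two_le.lt_of_ne (hq2 i).symm).trans_le (Nat.le_self_pow (by have := hu i; lia) _)
  choose ω hω hωp using fun i ↦
    DirichletCharacter.exists_odd_apply_eq_one (hlt i) hfodd (hpf' i)
  have h2 (i) : (2 : ZMod (q i ^ u i)) ^ (4 * f) = 1 := by
    by_contra h
    obtain ⟨ψ, hψ⟩ := DirichletCharacter.exists_apply_ne_one_of_hasEnoughRootsOfUnity ℂ h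
    refine hψ ?_
    rw [map_pow, mul_comm, pow_mul, ← MulChar.pow_apply' _ hfodd.pos.ne']
    refine apply_two_pow_four_eq_one hqp hq2 hdist ((ZMod.isUnit_iff_coprime _ _).mp hpu)
      (fun χ hχ ↦ DirichletCharacter.LFunction_zero_eq_zero_of_pure (by lia) hfodd.pos.ne' hpu
        hpure hχ) hω hωp ?_
    rw [MulChar.pow_apply' _ hfodd.pos.ne', ← map_pow, hpf', map_one]
  refine Fintype.prod_dvd_of_isRelPrime (fun i j hij ↦ ?_) fun i ↦ ?_
  · exact Nat.coprime_iff_isRelPrime.mp <|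
      Nat.Coprime.pow _ _ ((Nat.coprime_primes (hqp i) (hqp j)).mpr (hdist.ne hij))
  · rw [← ZMod.natCast_eq_zero_iff, Nat.cast_sub Nat.one_le_two_pow]
    simp [h2]
end
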